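/- arXiv:0901.4221 — 2 statements merged into one kernel-verified Lean document; each statement's English description precedes it below -/
import Mathlib

section
/- Every finite-dimensional Hopf algebra A over a field k is a Frobenius algebra; consequently a finite-dimensional left A-module is projective if and only if it is injective. -/
open Coalgebra HopfAlgebra WithConv
open scoped TensorProduct

section DualAction

variable {k C : Type*} [CommSemiring k] [AddCommMonoid C] [Module k C] [Coalgebra k C]

/-- The action `z ↦ φ(z₁) z₂` of a functional on a coalgebra. -/
noncomputable def Coalgebra.dualRightAct (φ : Module.Dual k C) : C →ₗ[k] C :=
  _root_.TensorProduct.lid k C ∘ₗ φ.rTensor C ∘ₗ comul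

/-- The action `z ↦ z₁ f(z₂)` of a functional on a coalgebra. -/
noncomputable def Coalgebra.dualLeftAct (f : Module.Dual k C) : C →ₗ[k] C :=
  _root_.TensorProduct.rid k C ∘ₗ f.lTensor C ∘ₗ comul

lemma Coalgebra.Repr.dualRightAct_apply {ι : Type*} {z : C} (r : Repr k z ι)
    (φ : Module.Dual k C) :
    dualRightAct φ z = ∑ i ∈ r.index, φ (r.left i) • r.right i := by
  simp [dualRightAct, ← r.eq]

lemma Coalgebra.Repr.dualLeftAct_apply {ι : Type*} {z : C} (r : Repr k z ι)
    (f : Module.Dual k C) :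
    dualLeftAct f z = ∑ i ∈ r.index, f (r.right i) • r.left i := by
  simp [dualLeftAct, ← r.eq]

lemma Coalgebra.counit_dualRightAct (φ : Module.Dual k C) (z : C) :
    counit (R := k) (dualRightAct φ z) = φ z := by
  have h := congr(φ (_root_.TensorProduct.rid k C $(sum_tmul_counit_eq (R := k) (ℛ k z))))
  simp only [map_sum, map_smul, _root_.TensorProduct.rid_tmul, one_smul, smul_eq_mul] at h
  simp only [(ℛ k z).dualRightAct_apply, map_sum, map_smul, smul_eq_mul, ← h, mul_comm]

lemma Coalgebra.dualRightAct_dualLeftAct (φ f : Module.Dual k C) (z : C) :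
    dualRightAct φ (dualLeftAct f z) = dualLeftAct f (dualRightAct φ z) := by
  have h := congr(_root_.TensorProduct.lid k C (_root_.TensorProduct.map φ
    ((_root_.TensorProduct.rid k C).toLinearMap ∘ₗ f.lTensor C)
    $(sum_tmul_tmul_eq (ℛ k z) (fun i => ℛ k ((ℛ k z).left i)) (fun i => ℛ k ((ℛ k z).right i)))))
  simp only [(ℛ k z).dualRightAct_apply, (ℛ k z).dualLeftAct_apply, map_sum, map_smul,
    (ℛ k ((ℛ k z).left _)).dualRightAct_apply, (ℛ k ((ℛ k z).right _)).dualLeftAct_apply]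
  simpa [Finset.smul_sum, smul_comm (f _)] using h

lemma Coalgebra.sum_basis_dualRightAct {ι κ V : Type*} [Fintype κ] [AddCommMonoid V] [Module k V]
    {M : Type*} [AddCommMonoid M] [Module k M] (b : Module.Basis κ k M)
    (β : M →ₗ[k] C →ₗ[k] V) (h : C →ₗ[k] M) {z : C} (r : Repr k z ι) :
    ∑ j, β (b j) (dualRightAct (b.coord j ∘ₗ h) z) =
      ∑ i ∈ r.index, β (h (r.left i)) (r.right i) := by
  simp only [r.dualRightAct_apply, map_sum, map_smul]
  rw [Finset.sum_comm]
  refine Finset.sum_congr rfl fun i _ => ?_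
  have h' := congr(β $(b.sum_repr (h (r.left i))) (r.right i))
  simpa only [map_sum, map_smul, LinearMap.sum_apply, LinearMap.smul_apply, LinearMap.comp_apply,
    Module.Basis.coord_apply] using h'

end DualAction

section Antipode

variable {k A : Type*} [CommSemiring k] [Semiring A] [HopfAlgebra k A]

lemma HopfAlgebra.comul_eq_convMul :
    toConv (comul : A →ₗ[k] A ⊗[k] A) =
      toConv (Algebra.TensorProduct.includeLeft (R := k) (S := k) (A := A) (B := A)).toLinearMap *
      toConv (Algebra.TensorProduct.includeRight (R := k) (A := A) (B := A)).toLinearMap := by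
  ext a
  rw [(ℛ k a).convMul_apply]
  simp [(ℛ k a).eq]

lemma HopfAlgebra.convMul_comp_antipode {B : Type*} [Semiring B] [Algebra k B] (f : A →ₐ[k] B) :
    toConv f.toLinearMap * toConv (f.toLinearMap ∘ₗ antipode k) = 1 := by
  have h := LinearMap.algHom_comp_convMul_distrib f (toConv LinearMap.id)
    (toConv (antipode k (A := A)))
  rw [LinearMap.id_mul_antipode] at h
  ext a
  simpa using congr($h.symm a)

lemma HopfAlgebra.comp_antipode_convMul {B : Type*} [Semiring B] [Algebra k B] (f : A →ₐ[k] B) :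
    toConv (f.toLinearMap ∘ₗ antipode k) * toConv f.toLinearMap = 1 := by
  have h := LinearMap.algHom_comp_convMul_distrib f (toConv (antipode k (A := A)))
    (toConv LinearMap.id)
  rw [LinearMap.antipode_mul_id] at h
  ext a
  simpa using congr($h.symm a)

lemma HopfAlgebra.comul_comp_antipode_eq_convMul :
    toConv ((comul : A →ₗ[k] A ⊗[k] A) ∘ₗ antipode k) =
      toConv ((Algebra.TensorProduct.includeRight (R := k) (A := A) (B := A)).toLinearMap ∘ₗ
        antipode k) *
      toConv ((Algebra.TensorProduct.includeLeft (R := k) (S := k) (A := A) (B := A)).toLinearMap ∘ₗ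
        antipode k) := by
  refine left_inv_eq_right_inv (comp_antipode_convMul (Bialgebra.comulAlgHom k A)) ?_
  rw [Bialgebra.toLinearMap_comulAlgHom, comul_eq_convMul, mul_assoc,
    ← mul_assoc (toConv (AlgHom.toLinearMap Algebra.TensorProduct.includeRight)),
    convMul_comp_antipode, one_mul, convMul_comp_antipode]

lemma Coalgebra.Repr.sum_antipode_tmul_one_mul_comul {ι : Type*} {a : A} (r : Repr k a ι) :
    ∑ i ∈ r.index, (antipode k (r.left i) ⊗ₜ[k] (1 : A)) * comul (r.right i) = 1 ⊗ₜ[k] a := by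
  have h : toConv ((Algebra.TensorProduct.includeLeft
      (R := k) (S := k) (A := A) (B := A)).toLinearMap ∘ₗ antipode k) * toConv comul =
      toConv (Algebra.TensorProduct.includeRight (R := k) (A := A) (B := A)).toLinearMap := by
    rw [comul_eq_convMul, ← mul_assoc, comp_antipode_convMul, one_mul]
  simpa [r.convMul_apply] using congr($h a)

lemma Coalgebra.Repr.sum_comul_antipode_mul_tmul_one {ι : Type*} {a : A} (r : Repr k a ι) :
    ∑ i ∈ r.index, comul (antipode k (r.left i)) * (r.right i ⊗ₜ[k] (1 : A)) =
      1 ⊗ₜ[k] antipode k a := by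
  have h : toConv ((comul : A →ₗ[k] A ⊗[k] A) ∘ₗ antipode k) *
      toConv (Algebra.TensorProduct.includeLeft
        (R := k) (S := k) (A := A) (B := A)).toLinearMap =
      toConv ((Algebra.TensorProduct.includeRight (R := k) (A := A) (B := A)).toLinearMap ∘ₗ
        antipode k) := by
    rw [comul_comp_antipode_eq_convMul, mul_assoc, comp_antipode_convMul, mul_one]
  simpa [r.convMul_apply] using congr($h a)

/-- The coproduct of `S(a)` is `S(a₂) ⊗ S(a₁)`. -/
noncomputable def Coalgebra.Repr.antipode {ι : Type*} {a : A} (r : Repr k a ι) :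
    Repr k (HopfAlgebra.antipode k a) ι where
  index := r.index
  left i := HopfAlgebra.antipode k (r.right i)
  right i := HopfAlgebra.antipode k (r.left i)
  eq := by
    simpa [r.convMul_apply] using congr($(comul_comp_antipode_eq_convMul (k := k) (A := A)) a).symm

lemma HopfAlgebra.dualRightAct_comp_mulRight (g : Module.Dual k A) (s w : A) :
    dualRightAct (g ∘ₗ LinearMap.mulRight k s) w =
      _root_.TensorProduct.lid k A (g.rTensor A (comul w * (s ⊗ₜ 1))) := by
  simp [(ℛ k w).dualRightAct_apply, ← (ℛ k w).eq, Finset.sum_mul]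

lemma HopfAlgebra.dualRightAct_comp_mulLeft (g : Module.Dual k A) (s w : A) :
    dualRightAct (g ∘ₗ LinearMap.mulLeft k s) w =
      _root_.TensorProduct.lid k A (g.rTensor A ((s ⊗ₜ 1) * comul w)) := by
  simp [(ℛ k w).dualRightAct_apply, ← (ℛ k w).eq, Finset.mul_sum]

lemma HopfAlgebra.lid_rTensor_mul_one_tmul (g : Module.Dual k A) (t : A ⊗[k] A) (a : A) :
    _root_.TensorProduct.lid k A (g.rTensor A (t * (1 ⊗ₜ a))) =
      _root_.TensorProduct.lid k A (g.rTensor A t) * a := by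
  induction t with
  | zero => simp
  | add x y hx hy => simp [add_mul, hx, hy]
  | tmul x y => simp

lemma HopfAlgebra.lid_rTensor_one_tmul_mul (g : Module.Dual k A) (t : A ⊗[k] A) (a : A) :
    _root_.TensorProduct.lid k A (g.rTensor A ((1 ⊗ₜ a) * t)) =
      a * _root_.TensorProduct.lid k A (g.rTensor A t) := by
  induction t with
  | zero => simp
  | add x y hx hy => simp [mul_add, hx, hy]
  | tmul x y => simp

variable {κ : Type*} [Fintype κ] (b : Module.Basis κ k A)

lemma HopfAlgebra.sum_dualRightAct_mul_antipode_sq (g : Module.Dual k A) (x q : A) :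
    ∑ j, dualRightAct (g ∘ₗ LinearMap.mulRight k (b j))
        (x * antipode k (antipode k (dualRightAct (b.coord j ∘ₗ antipode k) q))) =
      dualRightAct g x * antipode k (antipode k q) := by
  let β : A →ₗ[k] A →ₗ[k] A := LinearMap.mk₂ k
    (fun s w => _root_.TensorProduct.lid k A
      (g.rTensor A (comul (x * antipode k (antipode k w)) * (s ⊗ₜ 1))))
    (by simp [_root_.TensorProduct.add_tmul, mul_add]) (by simp [← _root_.TensorProduct.smul_tmul'])
    (by simp [mul_add, add_mul]) (by simp)
  have h := sum_basis_dualRightAct b β (antipode k) (ℛ k q)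
  simp only [dualRightAct_comp_mulRight]
  refine h.trans ?_
  simp only [β, LinearMap.mk₂_apply, Bialgebra.comul_mul, mul_assoc, ← map_sum, ← Finset.mul_sum]
  have h2 := (ℛ k q).antipode.sum_comul_antipode_mul_tmul_one
  simp only [Coalgebra.Repr.antipode] at h2
  rw [h2, lid_rTensor_mul_one_tmul]
  rfl

lemma HopfAlgebra.sum_dualRightAct_antipode_mul (g : Module.Dual k A) (x q : A) :
    ∑ j, dualRightAct (g ∘ₗ LinearMap.mulLeft k (b j))
        (dualRightAct (b.coord j ∘ₗ antipode k) q * x) = q * dualRightAct g x := by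
  let β : A →ₗ[k] A →ₗ[k] A := LinearMap.mk₂ k
    (fun s w => _root_.TensorProduct.lid k A (g.rTensor A ((s ⊗ₜ 1) * comul (w * x))))
    (by simp [_root_.TensorProduct.add_tmul, add_mul]) (by simp [← _root_.TensorProduct.smul_tmul'])
    (by simp [mul_add, add_mul]) (by simp)
  have h := sum_basis_dualRightAct b β (antipode k) (ℛ k q)
  simp only [dualRightAct_comp_mulLeft]
  refine h.trans ?_
  simp only [β, LinearMap.mk₂_apply, Bialgebra.comul_mul, ← mul_assoc, ← map_sum, ← Finset.sum_mul]
  rw [(ℛ k q).sum_antipode_tmul_one_mul_comul, lid_rTensor_one_tmul_mul]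
  rfl

lemma HopfAlgebra.sum_dualRightAct_dualRightAct (g : Module.Dual k A) (z : A) :
    ∑ j, dualRightAct (b.coord j ∘ₗ antipode k)
      (dualRightAct (g ∘ₗ LinearMap.mulRight k (b j)) z) = g 1 • z := by
  have h := congr(_root_.TensorProduct.lid k A ((g ∘ₗ LinearMap.mul' k A).rTensor A
    ((_root_.TensorProduct.assoc k A A A).symm (((antipode k).rTensor A).lTensor A
    $(sum_tmul_tmul_eq (ℛ k z) (fun i => ℛ k ((ℛ k z).left i))
      (fun i => ℛ k ((ℛ k z).right i)))))))
  simp only [map_sum, LinearMap.lTensor_tmul, LinearMap.rTensor_tmul, LinearMap.comp_apply,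
    _root_.TensorProduct.assoc_symm_tmul, _root_.TensorProduct.lid_tmul, LinearMap.mul'_apply,
    ← Finset.sum_smul] at h
  simp only [← map_sum, sum_mul_antipode_eq_smul, map_smul, smul_assoc] at h
  calc
    _ = ∑ i ∈ (ℛ k z).index, ∑ j, g ((ℛ k z).left i * b j) •
        dualRightAct (b.coord j ∘ₗ antipode k) ((ℛ k z).right i) := by
      simp only [(ℛ k z).dualRightAct_apply, map_sum, map_smul, LinearMap.comp_apply,
        LinearMap.mulRight_apply]
      rw [Finset.sum_comm]
    _ = ∑ i ∈ (ℛ k z).index, ∑ m ∈ (ℛ k ((ℛ k z).right i)).index,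
        g ((ℛ k z).left i * antipode k ((ℛ k ((ℛ k z).right i)).left m)) •
          (ℛ k ((ℛ k z).right i)).right m :=
      Finset.sum_congr rfl fun i _ => sum_basis_dualRightAct b
        (LinearMap.lsmul k A ∘ₗ g ∘ₗ LinearMap.mulLeft k ((ℛ k z).left i)) (antipode k) _
    _ = _ := by
      rw [← h]
      simp only [smul_comm _ (g 1), ← Finset.smul_sum, sum_counit_smul]

end Antipode

section Integral

variable {k A : Type*} [Field k] [Ring A] [HopfAlgebra k A]

/-- The functional `x ↦ tr(y ↦ x S²(y₁) f(y₂))`, a left integral on `A` for every `f`. -/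
noncomputable def HopfAlgebra.traceIntegral (f : Module.Dual k A) : Module.Dual k A :=
  LinearMap.trace k A ∘ₗ
    LinearMap.lcomp k A (antipode k ∘ₗ antipode k ∘ₗ dualLeftAct f) ∘ₗ LinearMap.mul k A

lemma HopfAlgebra.traceIntegral_apply (f : Module.Dual k A) (x : A) :
    traceIntegral f x = LinearMap.trace k A
      (LinearMap.mulLeft k x ∘ₗ antipode k ∘ₗ antipode k ∘ₗ dualLeftAct f) := rfl

variable [FiniteDimensional k A]

lemma HopfAlgebra.traceIntegral_dualRightAct (f g : Module.Dual k A) (x : A) :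
    traceIntegral f (dualRightAct g x) = g 1 * traceIntegral f x := by
  let b := Module.finBasis k A
  let G (j) := dualRightAct (g ∘ₗ LinearMap.mulRight k (b j))
  let Q (j) := LinearMap.mulLeft k x ∘ₗ antipode k ∘ₗ antipode k ∘ₗ
    dualRightAct (b.coord j ∘ₗ antipode k) ∘ₗ dualLeftAct f
  have h₁ : LinearMap.mulLeft k (dualRightAct g x) ∘ₗ antipode k ∘ₗ antipode k ∘ₗ dualLeftAct f =
      ∑ j, G j ∘ₗ Q j := by
    ext y
    simpa [G, Q] using (sum_dualRightAct_mul_antipode_sq b g x (dualLeftAct f y)).symm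
  have h₂ : ∑ j, Q j ∘ₗ G j = g 1 •
      (LinearMap.mulLeft k x ∘ₗ antipode k ∘ₗ antipode k ∘ₗ dualLeftAct f) := by
    ext y
    simp only [LinearMap.sum_apply, LinearMap.comp_apply, G, Q, dualRightAct_dualLeftAct,
      ← map_sum, sum_dualRightAct_dualRightAct, map_smul, LinearMap.smul_apply]
  rw [traceIntegral_apply, h₁, map_sum]
  simp only [LinearMap.trace_comp_comm' (Q _)]
  rw [← map_sum, h₂, map_smul, smul_eq_mul, traceIntegral_apply]

variable (k A) in
lemma HopfAlgebra.exists_traceIntegral_ne_zero : ∃ f : Module.Dual k A, traceIntegral f ≠ 0 := by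
  by_contra! h
  let b := Module.finBasis k A
  have h₁ : ∑ j, LinearMap.mulLeft k (antipode k (b j)) ∘ₗ antipode k ∘ₗ antipode k ∘ₗ
      dualLeftAct (b.coord j) = (counit (R := k) (A := A)).smulRight (1 : A) := by
    ext y
    simp only [LinearMap.sum_apply, LinearMap.comp_apply, LinearMap.mulLeft_apply,
      LinearMap.smulRight_apply, (ℛ k y).dualLeftAct_apply, map_sum, map_smul,
      ← antipode_mul_antidistrib]
    rw [Finset.sum_comm]
    simp only [← map_smul, ← map_sum, ← mul_smul_comm, ← Finset.mul_sum, Module.Basis.coord_apply,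
      Module.Basis.sum_repr, sum_antipode_mul_eq_smul]
    simp
  have h₂ := congr(LinearMap.trace k A $h₁)
  rw [map_sum, LinearMap.trace_smulRight, Bialgebra.counit_one] at h₂
  simp only [← traceIntegral_apply, h, LinearMap.zero_apply, Finset.sum_const_zero] at h₂
  exact zero_ne_one h₂

/-- A nonzero left integral `l` on `A` is nondegenerate. -/
lemma HopfAlgebra.eq_zero_of_integral_mul_eq_zero {l : Module.Dual k A} (hl : l ≠ 0)
    (hint : ∀ (g : Module.Dual k A) (x : A), l (dualRightAct g x) = g 1 * l x)
    {y : A} (hy : ∀ x, l (x * y) = 0) : y = 0 := by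
  let b := Module.finBasis k A
  have hact {z : A} (hz : ∀ x, l (x * z) = 0) (φ : Module.Dual k A) (x : A) :
      l (x * dualRightAct φ z) = 0 := by
    rw [← sum_dualRightAct_antipode_mul b, map_sum]
    exact Finset.sum_eq_zero fun j _ => by rw [hint, hz, mul_zero]
  have hcounit {z : A} (hz : ∀ x, l (x * z) = 0) : counit (R := k) z = 0 := by
    obtain ⟨x, hx⟩ : ∃ x, l x ≠ 0 := by
      by_contra! h
      exact hl (LinearMap.ext h)
    have h := congr(l $(sum_basis_dualRightAct b
      (LinearMap.mul k A ∘ₗ LinearMap.mulLeft k x ∘ₗ antipode k) LinearMap.id (ℛ k z)))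
    simp only [LinearMap.comp_apply, LinearMap.mul_apply', LinearMap.mulLeft_apply,
      LinearMap.id_apply, mul_assoc x, ← Finset.mul_sum, sum_antipode_mul_eq_smul,
      mul_smul_comm, map_smul, mul_one] at h
    rw [← mul_eq_zero_iff_right hx, ← smul_eq_mul, ← h, Finset.mul_sum, map_sum]
    exact Finset.sum_eq_zero fun j _ => by rw [← mul_assoc, hact hz]
  refine (Module.forall_dual_apply_eq_zero_iff k y).1 fun φ => ?_
  rw [← counit_dualRightAct, hcounit (hact hy φ)]

variable (k A) in
/-- A finite-dimensional Hopf algebra is a Frobenius algebra. -/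
lemma HopfAlgebra.exists_frobenius_equiv :
    ∃ e : A ≃ₗ[k] Module.Dual k A, ∀ a b x : A, e (a * b) x = e b (x * a) := by
  obtain ⟨f, hf⟩ := exists_traceIntegral_ne_zero k A
  let F : A →ₗ[k] Module.Dual k A :=
    (LinearMap.llcomp k A A k (traceIntegral f)) ∘ₗ (LinearMap.mul k A).flip
  have hF : Function.Injective F := (injective_iff_map_eq_zero F).2 fun y hy =>
    eq_zero_of_integral_mul_eq_zero hf (traceIntegral_dualRightAct f)
      fun x => LinearMap.congr_fun hy x
  exact ⟨LinearEquiv.ofInjectiveOfFinrankEq F hF Subspace.dual_finrank_eq.symm,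
    fun a b x => congr(traceIntegral f $((mul_assoc x a b).symm))⟩

end Integral

section Frobenius

variable {k A : Type*} [Field k] [Ring A] [Algebra k A]
lemma Module.Baer.of_frobenius (e : A ≃ₗ[k] Module.Dual k A)
    (he : ∀ a b x : A, e (a * b) x = e b (x * a)) : Module.Baer A A := by
  intro I g
  let φ : I.restrictScalars k →ₗ[k] k := LinearMap.applyₗ (1 : A) ∘ₗ e.toLinearMap ∘ₗ
    g.restrictScalars k
  obtain ⟨ψ, hψ⟩ := φ.exists_extend
  refine ⟨LinearMap.toSpanSingleton A A (e.symm ψ), fun x hx => ?_⟩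
  apply e.injective
  ext y
  have h := LinearMap.congr_fun hψ ⟨y * x, I.mul_mem_left y hx⟩
  have h' : g ⟨y * x, I.mul_mem_left y hx⟩ = y * g ⟨x, hx⟩ := map_smul g y ⟨x, hx⟩
  simp only [LinearMap.comp_apply, Submodule.subtype_apply] at h
  rw [LinearMap.toSpanSingleton_apply, smul_eq_mul, he, LinearEquiv.apply_symm_apply, h]
  change e (g ⟨y * x, I.mul_mem_left y hx⟩) 1 = _
  rw [h', he, one_mul]

lemma Module.Baer.pi {R ι : Type*} [Ring R] {M : ι → Type*} [∀ i, AddCommGroup (M i)]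
    [∀ i, Module R (M i)] (h : ∀ i, Module.Baer R (M i)) : Module.Baer R (∀ i, M i) := by
  intro I g
  choose g' hg' using fun i => h i I (LinearMap.proj i ∘ₗ g)
  exact ⟨LinearMap.pi g', fun x hx => funext fun i => hg' i x hx⟩

lemma Module.Baer.of_retract {R M N : Type*} [Ring R] [AddCommGroup M] [AddCommGroup N]
    [Module R M] [Module R N] (h : Module.Baer R N) (s : M →ₗ[R] N) (p : N →ₗ[R] M)
    (hps : p ∘ₗ s = LinearMap.id) : Module.Baer R M := by
  intro I g
  obtain ⟨g', hg'⟩ := h I (s ∘ₗ g)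
  exact ⟨p ∘ₗ g', fun x hx => by
    rw [LinearMap.comp_apply, hg' x hx]
    exact LinearMap.congr_fun hps _⟩

lemma Module.exists_injective_to_pi_of_frobenius (e : A ≃ₗ[k] Module.Dual k A)
    (he : ∀ a b x : A, e (a * b) x = e b (x * a))
    (M : Type*) [AddCommGroup M] [Module k M] [Module A M] [IsScalarTower k A M]
    [Module.Finite k M] : ∃ (n : ℕ) (f : M →ₗ[A] Fin n → A), Function.Injective f := by
  let b := Module.finBasis k M
  let F (j : Fin (Module.finrank k M)) : M →ₗ[A] A :=
    { toFun m := e.symm (b.coord j ∘ₗ (LinearMap.toSpanSingleton A M m).restrictScalars k)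
      map_add' m m' := by
        rw [← map_add]
        congr 1
        ext x
        simp
      map_smul' a m := by
        apply e.injective
        ext x
        simp [he, mul_smul] }
  refine ⟨_, LinearMap.pi F, (injective_iff_map_eq_zero _).2 fun m hm => ?_⟩
  refine b.ext_elem fun j => ?_
  have h := congr(e $(congr_fun hm j) 1)
  simpa [F] using h

lemma Module.Baer.of_injective_of_finite {M : Type*} [AddCommGroup M] [Module k M] [Module A M]
    [IsScalarTower k A M] [FiniteDimensional k A] (h : Module.Injective A M) :
    Module.Baer A M := by
  cases subsingleton_or_nontrivial M with
  | inl _ => exact fun I g => ⟨0, fun x hx => Subsingleton.elim _ _⟩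
  | inr _ =>
    obtain ⟨m, hm⟩ := exists_ne (0 : M)
    have : Small k := small_of_injective (smul_left_injective k hm)
    have : Small A := small_of_injective (Module.finBasis k A).equivFun.injective
    exact Module.Baer.of_injective h

lemma Module.projective_iff_injective_of_frobenius [FiniteDimensional k A]
    (e : A ≃ₗ[k] Module.Dual k A)
    (he : ∀ a b x : A, e (a * b) x = e b (x * a))
    (M : Type*) [AddCommGroup M] [Module k M] [Module A M] [IsScalarTower k A M]
    [Module.Finite k M] : Module.Projective A M ↔ Module.Injective A M := by
  constructor
  · intro _
    have : Module.Finite A M := Module.Finite.of_restrictScalars_finite k A M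
    obtain ⟨n, p, hp⟩ := Module.Finite.exists_fin' A M
    obtain ⟨s, hs⟩ := Module.projective_lifting_property p LinearMap.id hp
    exact ((Module.Baer.pi fun _ => Module.Baer.of_frobenius e he).of_retract s p hs).injective
  · intro h
    obtain ⟨n, f, hf⟩ := Module.exists_injective_to_pi_of_frobenius e he M
    obtain ⟨p, hp⟩ :=
      (Module.Baer.of_injective_of_finite (k := k) h).extension_property f hf LinearMap.id
    exact Module.Projective.of_split f p hp

end Frobenius

/-- A finite-dimensional Hopf algebra over a field is a Frobenius algebra
(`A ≅ A*` as left `A`-modules, where `A*` carries the action `(a⇀λ)(b) = λ(ba)`);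
consequently a finite-dimensional left `A`-module is projective iff it is injective. -/
theorem hopf_frobenius_and_proj_iff_inj (k A : Type*) [Field k] [Ring A]
    [HopfAlgebra k A] [FiniteDimensional k A] :
    (∃ e : A ≃ₗ[k] Module.Dual k A, ∀ a b x : A, e (a * b) x = e b (x * a)) ∧
    (∀ (M : Type*) [AddCommGroup M] [Module k M] [Module A M] [IsScalarTower k A M],
      Module.Finite k M → (Module.Projective A M ↔ Module.Injective A M)) := by
  obtain ⟨e, he⟩ := exists_frobenius_equiv k A
  exact ⟨⟨e, he⟩, fun M _ _ _ _ _ => Module.projective_iff_injective_of_frobenius e he M⟩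
end

section
/- The antipode of a finite-dimensional Hopf algebra over a field is bijective. -/
open Coalgebra (Repr coassoc_apply)
open CoalgebraStruct (comul counit)
open Algebra.TensorProduct (includeLeft includeRight)
open HopfAlgebra TensorProduct WithConv
open scoped Coalgebra

namespace LinearMap

variable {R C : Type*} [CommSemiring R] [AddCommMonoid C] [Module R C] [Coalgebra R C]

/-- The map `c ↦ ∑ φ(c₍₁₎) c₍₂₎` attached to a functional `φ`. -/
noncomputable def comulContractLeft (φ : C →ₗ[R] R) : C →ₗ[R] C :=
  (TensorProduct.lid R C).toLinearMap ∘ₗ φ.rTensor C ∘ₗ comul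

/-- The map `c ↦ ∑ c₍₁₎ φ(c₍₂₎)` attached to a functional `φ`. -/
noncomputable def comulContractRight (φ : C →ₗ[R] R) : C →ₗ[R] C :=
  (TensorProduct.rid R C).toLinearMap ∘ₗ φ.lTensor C ∘ₗ comul

lemma comulContractLeft_apply (φ : C →ₗ[R] R) (c : C) :
    comulContractLeft φ c = TensorProduct.lid R C (φ.rTensor C (comul c)) := rfl

lemma comulContractRight_apply (φ : C →ₗ[R] R) (c : C) :
    comulContractRight φ c = TensorProduct.rid R C (φ.lTensor C (comul c)) := rfl

@[simp] lemma comulContractLeft_counit :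
    comulContractLeft (counit : C →ₗ[R] R) = LinearMap.id := by
  ext c
  simp [comulContractLeft_apply]

lemma counit_comulContractRight (φ : C →ₗ[R] R) (c : C) :
    counit (comulContractRight φ c) = φ c := by
  have h : φ (TensorProduct.lid R C (counit.rTensor C (comul c))) = φ c := by simp
  rw [← h, comulContractRight_apply]
  generalize comul (R := R) c = t
  induction t with
  | zero => simp
  | add x y hx hy => simp only [map_add, hx, hy]
  | tmul x y => simp [mul_comm]

lemma comulContractLeft_comp_comulContractRight (φ ψ : C →ₗ[R] R) :
    comulContractLeft φ ∘ₗ comulContractRight ψ = comulContractRight ψ ∘ₗ comulContractLeft φ := by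
  ext c
  let T : C ⊗[R] (C ⊗[R] C) →ₗ[R] C :=
    (TensorProduct.lid R C).toLinearMap ∘ₗ
      TensorProduct.map φ ((TensorProduct.rid R C).toLinearMap ∘ₗ ψ.lTensor C)
  have h := congrArg T (coassoc_apply (R := R) c)
  have h₁ : ∀ t : C ⊗[R] C, T (TensorProduct.assoc R C C C (comul.rTensor C t)) =
      comulContractLeft φ (TensorProduct.rid R C (ψ.lTensor C t)) := by
    intro t
    induction t with
    | zero => simp
    | add x y hx hy => simp only [map_add, hx, hy]
    | tmul x y =>
      simp only [LinearMap.rTensor_tmul, LinearMap.lTensor_tmul, TensorProduct.rid_tmul, map_smul,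
        comulContractLeft_apply]
      generalize comul (R := R) x = s
      induction s with
      | zero => simp
      | add x y hx hy => simp only [map_add, hx, hy, TensorProduct.add_tmul, smul_add]
      | tmul u v => simp [T, smul_smul, mul_comm]
  have h₂ : ∀ t : C ⊗[R] C, T (comul.lTensor C t) =
      comulContractRight ψ (TensorProduct.lid R C (φ.rTensor C t)) := by
    intro t
    induction t with
    | zero => simp
    | add x y hx hy => simp only [map_add, hx, hy]
    | tmul x y => simp [T, comulContractRight_apply]
  rw [h₁, h₂] at h
  exact h

lemma comulContractLeft_comp_comulContractLeft (φ ψ : C →ₗ[R] R) :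
    comulContractLeft ψ ∘ₗ comulContractLeft φ =
      comulContractLeft (toConv φ * toConv ψ).ofConv := by
  ext c
  let T : C ⊗[R] (C ⊗[R] C) →ₗ[R] C :=
    (TensorProduct.lid R C).toLinearMap ∘ₗ
      TensorProduct.map φ ((TensorProduct.lid R C).toLinearMap ∘ₗ ψ.rTensor C)
  have h := congrArg T (coassoc_apply (R := R) c)
  have h₁ : ∀ t : C ⊗[R] C, T (TensorProduct.assoc R C C C (comul.rTensor C t)) =
      TensorProduct.lid R C ((toConv φ * toConv ψ).ofConv.rTensor C t) := by
    intro t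
    induction t with
    | zero => simp
    | add x y hx hy => simp only [map_add, hx, hy]
    | tmul x y =>
      simp only [LinearMap.rTensor_tmul, TensorProduct.lid_tmul, LinearMap.convMul_def,
        ofConv_toConv, LinearMap.comp_apply]
      generalize comul (R := R) x = s
      induction s with
      | zero => simp
      | add x y hx hy => simp only [map_add, hx, hy, TensorProduct.add_tmul, add_smul]
      | tmul u v => simp [T, smul_smul, mul_comm]
  have h₂ : ∀ t : C ⊗[R] C, T (comul.lTensor C t) =
      comulContractLeft ψ (TensorProduct.lid R C (φ.rTensor C t)) := by
    intro t
    induction t with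
    | zero => simp
    | add x y hx hy => simp only [map_add, hx, hy]
    | tmul x y => simp [T, comulContractLeft_apply]
  rw [h₁, h₂] at h
  exact h.symm

lemma comulContractLeft_sum {ι : Type*} (s : Finset ι) (φ : ι → C →ₗ[R] R) :
    comulContractLeft (∑ i ∈ s, φ i) = ∑ i ∈ s, comulContractLeft (φ i) := by
  ext c
  simp [comulContractLeft_apply, ← LinearMap.coe_rTensorHom]

lemma comulContractLeft_smul (r : R) (φ : C →ₗ[R] R) :
    comulContractLeft (r • φ) = r • comulContractLeft φ := by
  ext c
  simp [comulContractLeft_apply]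

variable {ι : Type*} [Fintype ι] (b : Module.Basis ι R C)

lemma sum_basis_tmul_comulContractLeft (c : C) :
    ∑ i, b i ⊗ₜ[R] comulContractLeft (b.coord i) c = comul c := by
  simp only [comulContractLeft_apply]
  generalize comul (R := R) c = t
  induction t with
  | zero => simp
  | add x y hx hy => simp only [map_add, TensorProduct.tmul_add, Finset.sum_add_distrib, hx, hy]
  | tmul x y =>
    simp only [LinearMap.rTensor_tmul, TensorProduct.lid_tmul, ← TensorProduct.smul_tmul,
      ← TensorProduct.sum_tmul, Module.Basis.coord_apply, b.sum_repr]

lemma sum_comulContractRight_tmul_basis (c : C) :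
    ∑ i, comulContractRight (b.coord i) c ⊗ₜ[R] b i = comul c := by
  simp only [comulContractRight_apply]
  generalize comul (R := R) c = t
  induction t with
  | zero => simp
  | add x y hx hy => simp only [map_add, TensorProduct.add_tmul, Finset.sum_add_distrib, hx, hy]
  | tmul x y =>
    simp only [LinearMap.lTensor_tmul, TensorProduct.rid_tmul, TensorProduct.smul_tmul,
      ← TensorProduct.tmul_sum, Module.Basis.coord_apply, b.sum_repr]

end LinearMap

namespace HopfAlgebra

open LinearMap (comulContractLeft comulContractRight comulContractLeft_apply
  comulContractRight_apply comulContractLeft_counit counit_comulContractRight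
  comulContractLeft_comp_comulContractRight comulContractLeft_comp_comulContractLeft
  comulContractLeft_sum comulContractLeft_smul sum_basis_tmul_comulContractLeft
  sum_comulContractRight_tmul_basis)

section Semiring

variable {R A : Type*} [CommSemiring R] [Semiring A] [HopfAlgebra R A]

/-- The antipode, composed with an algebra homomorphism, is a convolution inverse. -/
lemma comp_antipode_convMul_s15 {B : Type*} [Semiring B] [Algebra R B] (f : A →ₐ[R] B) :
    toConv (f.toLinearMap ∘ₗ antipode R) * toConv f.toLinearMap = 1 := by
  have h := LinearMap.algHom_comp_convMul_distrib f (toConv (antipode R (A := A)))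
    (toConv LinearMap.id)
  rw [LinearMap.antipode_mul_id] at h
  apply ofConv_injective
  rw [ofConv_toConv, LinearMap.comp_id] at h
  rw [← h]
  ext
  simp [LinearMap.convOne_def]

lemma convMul_comp_antipode_s15 {B : Type*} [Semiring B] [Algebra R B] (f : A →ₐ[R] B) :
    toConv f.toLinearMap * toConv (f.toLinearMap ∘ₗ antipode R) = 1 := by
  have h := LinearMap.algHom_comp_convMul_distrib f (toConv LinearMap.id)
    (toConv (antipode R (A := A)))
  rw [LinearMap.id_mul_antipode] at h
  apply ofConv_injective
  rw [ofConv_toConv, LinearMap.comp_id] at h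
  rw [← h]
  ext
  simp [LinearMap.convOne_def]

lemma includeLeft_convMul_includeRight :
    toConv (includeLeft : A →ₐ[R] A ⊗[R] A).toLinearMap *
        toConv (includeRight : A →ₐ[R] A ⊗[R] A).toLinearMap =
      toConv (comul : A →ₗ[R] A ⊗[R] A) := by
  ext a
  rw [(ℛ R a).convMul_apply]
  simp [(ℛ R a).eq]

lemma comul_comp_antipode_eq_convMul_s15 :
    toConv (comul ∘ₗ antipode R : A →ₗ[R] A ⊗[R] A) =
      toConv ((includeRight : A →ₐ[R] A ⊗[R] A).toLinearMap ∘ₗ antipode R) *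
        toConv ((includeLeft : A →ₐ[R] A ⊗[R] A).toLinearMap ∘ₗ antipode R) := by
  refine (left_inv_eq_right_inv ?_ (LinearMap.comul_right_inv (R := R) (C := A))).symm
  rw [← includeLeft_convMul_includeRight, mul_assoc,
    ← mul_assoc _ (toConv (includeLeft : A →ₐ[R] A ⊗[R] A).toLinearMap), comp_antipode_convMul_s15,
    one_mul, comp_antipode_convMul_s15]

lemma comul_antipode (a : A) :
    comul (antipode R a) =
      TensorProduct.map (antipode R) (antipode R) (TensorProduct.comm R A A (comul a)) := by
  have h := congr($(comul_comp_antipode_eq_convMul_s15 (R := R) (A := A)) a)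
  rw [(ℛ R a).convMul_apply] at h
  rw [← (ℛ R a).eq]
  simpa using h

/-- `∑ Δ(S(a₍₁₎)) (a₍₂₎ ⊗ 1) = 1 ⊗ S(a)`. -/
lemma comul_antipode_convMul_includeLeft :
    toConv (comul ∘ₗ antipode R : A →ₗ[R] A ⊗[R] A) *
        toConv (includeLeft : A →ₐ[R] A ⊗[R] A).toLinearMap =
      toConv ((includeRight : A →ₐ[R] A ⊗[R] A).toLinearMap ∘ₗ antipode R) := by
  rw [comul_comp_antipode_eq_convMul_s15, mul_assoc, comp_antipode_convMul_s15, mul_one]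

/-- `∑ (1 ⊗ a₍₁₎) Δ(S(a₍₂₎)) = S(a) ⊗ 1`. -/
lemma includeRight_convMul_comul_antipode :
    toConv (includeRight : A →ₐ[R] A ⊗[R] A).toLinearMap *
        toConv (comul ∘ₗ antipode R : A →ₗ[R] A ⊗[R] A) =
      toConv ((includeLeft : A →ₐ[R] A ⊗[R] A).toLinearMap ∘ₗ antipode R) := by
  rw [comul_comp_antipode_eq_convMul_s15, ← mul_assoc, convMul_comp_antipode_s15, one_mul]

lemma map_antipode_comm_mul (s t : A ⊗[R] A) :
    TensorProduct.map (antipode R) (antipode R) (TensorProduct.comm R A A (s * t)) =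
      TensorProduct.map (antipode R) (antipode R) (TensorProduct.comm R A A t) *
        TensorProduct.map (antipode R) (antipode R) (TensorProduct.comm R A A s) := by
  induction s with
  | zero => simp
  | add x y hx hy => simp only [add_mul, mul_add, map_add, hx, hy]
  | tmul x y =>
    induction t with
    | zero => simp
    | add x y hx hy => simp only [add_mul, mul_add, map_add, hx, hy]
    | tmul u v => simp [antipode_mul_antidistrib]

/-- `∑ Δ(S²(a₍₂₎)) (S(a₍₁₎) ⊗ 1) = 1 ⊗ S²(a)`. -/
lemma sum_comul_antipode_antipode_mul {ι : Type*} {a : A} (r : Repr R a ι) :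
    ∑ i ∈ r.index, comul (antipode R (antipode R (r.right i))) *
      (antipode R (r.left i) ⊗ₜ[R] (1 : A)) = (1 : A) ⊗ₜ[R] antipode R (antipode R a) := by
  have h := congr($(includeRight_convMul_comul_antipode (R := R) (A := A)) a)
  rw [r.convMul_apply] at h
  have h' := congrArg
    (fun t ↦ TensorProduct.map (antipode R) (antipode R) (TensorProduct.comm R A A t)) h
  simpa [map_antipode_comm_mul, ← comul_antipode] using h'

end Semiring

variable {k A : Type*} [Field k] [Ring A] [HopfAlgebra k A]

/-- The functional `x ↦ Tr (y ↦ ∑ x S²(y₍₁₎) f(y₍₂₎))`. -/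
noncomputable def traceIntegral_s15 (f : A →ₗ[k] k) : A →ₗ[k] k :=
  LinearMap.trace k A ∘ₗ
    LinearMap.lcomp k A (antipode k ∘ₗ antipode k ∘ₗ comulContractRight f) ∘ₗ LinearMap.mul k A

lemma traceIntegral_apply_s15 (f : A →ₗ[k] k) (x : A) :
    traceIntegral_s15 f x = LinearMap.trace k A
      (LinearMap.mulLeft k x ∘ₗ antipode k ∘ₗ antipode k ∘ₗ comulContractRight f) := rfl

lemma sum_basis_mul_smul_comulContractLeft {ι : Type*} [Fintype ι] (b : Module.Basis ι k A)
    (φ : A →ₗ[k] k) (c z : A) :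
    ∑ i, φ (b i * c) • comulContractLeft (b.coord i) z =
      TensorProduct.lid k A (φ.rTensor A (comul z * (c ⊗ₜ[k] (1 : A)))) := by
  rw [← sum_basis_tmul_comulContractLeft b z]
  simp [Finset.sum_mul]

lemma mulLeft_comulContractLeft_comp_antipode_antipode {ι : Type*} [Fintype ι]
    (b : Module.Basis ι k A) (φ : A →ₗ[k] k) (x : A) :
    LinearMap.mulLeft k (comulContractLeft φ x) ∘ₗ antipode k ∘ₗ antipode k =
      ∑ i, comulContractLeft (b.coord i) ∘ₗ LinearMap.mulLeft k x ∘ₗ antipode k ∘ₗ antipode k ∘ₗ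
        comulContractLeft (φ ∘ₗ LinearMap.mulLeft k (b i) ∘ₗ antipode k) := by
  ext y
  have h : ∀ i, comulContractLeft (φ ∘ₗ LinearMap.mulLeft k (b i) ∘ₗ antipode k) y =
      ∑ j ∈ (ℛ k y).index, φ (b i * antipode k ((ℛ k y).left j)) • (ℛ k y).right j := by
    intro i
    rw [comulContractLeft_apply, ← (ℛ k y).eq]
    simp
  simp only [LinearMap.sum_apply, LinearMap.comp_apply, h, map_sum, map_smul,
    LinearMap.mulLeft_apply]
  rw [Finset.sum_comm]
  simp only [sum_basis_mul_smul_comulContractLeft]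
  simp only [← map_sum, Bialgebra.comul_mul, mul_assoc, ← Finset.mul_sum,
    sum_comul_antipode_antipode_mul]
  rw [comulContractLeft_apply]
  generalize comul (R := k) x = t
  induction t with
  | zero => simp
  | add u v hu hv => simp only [map_add, add_mul, hu, hv]
  | tmul u v => simp

lemma sum_comulContractLeft_comp_comulContractLeft_coord {ι : Type*} [Fintype ι]
    (b : Module.Basis ι k A) (φ : A →ₗ[k] k) :
    ∑ i, comulContractLeft (φ ∘ₗ LinearMap.mulLeft k (b i) ∘ₗ antipode k) ∘ₗ
      comulContractLeft (b.coord i) = φ 1 • LinearMap.id := by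
  have h : ∑ i, (toConv (b.coord i) *
      toConv (φ ∘ₗ LinearMap.mulLeft k (b i) ∘ₗ antipode k)).ofConv = φ 1 • counit := by
    ext y
    have h' : ∀ i, (toConv (b.coord i) *
        toConv (φ ∘ₗ LinearMap.mulLeft k (b i) ∘ₗ antipode k)).ofConv y =
        ∑ j ∈ (ℛ k y).index, b.coord i ((ℛ k y).left j) *
          φ (b i * antipode k ((ℛ k y).right j)) := fun i ↦ (ℛ k y).convMul_apply _ _
    simp only [LinearMap.sum_apply, h']
    rw [Finset.sum_comm]
    have h'' : ∀ c z, ∑ i, b.coord i c * φ (b i * z) = φ (c * z) := by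
      intro c z
      conv_rhs => rw [← b.sum_repr c]
      simp only [Finset.sum_mul, smul_mul_assoc, map_sum, map_smul, smul_eq_mul,
        Module.Basis.coord_apply]
    simp only [h'']
    rw [← map_sum, sum_mul_antipode_eq_smul]
    simp [mul_comm]
  simp only [comulContractLeft_comp_comulContractLeft]
  rw [← comulContractLeft_sum, h, comulContractLeft_smul, comulContractLeft_counit]

lemma traceIntegral_comulContractLeft [FiniteDimensional k A] (f φ : A →ₗ[k] k) (x : A) :
    traceIntegral_s15 f (comulContractLeft φ x) = φ 1 * traceIntegral_s15 f x := by
  let b := Module.finBasis k A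
  let N : A →ₗ[k] A := LinearMap.mulLeft k x ∘ₗ antipode k ∘ₗ antipode k ∘ₗ comulContractRight f
  let m (i) : A →ₗ[k] A := comulContractLeft (φ ∘ₗ LinearMap.mulLeft k (b i) ∘ₗ antipode k)
  have h : LinearMap.mulLeft k (comulContractLeft φ x) ∘ₗ antipode k ∘ₗ antipode k ∘ₗ
      comulContractRight f = ∑ i, comulContractLeft (b.coord i) ∘ₗ N ∘ₗ m i := by
    ext y
    have h' := LinearMap.congr_fun (mulLeft_comulContractLeft_comp_antipode_antipode b φ x)
      (comulContractRight f y)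
    have h'' := fun i ↦ LinearMap.congr_fun (comulContractLeft_comp_comulContractRight
      (φ ∘ₗ LinearMap.mulLeft k (b i) ∘ₗ antipode k) f) y
    simp only [LinearMap.comp_apply] at h''
    simpa only [LinearMap.sum_apply, LinearMap.comp_apply, h'', N, m] using h'
  rw [traceIntegral_apply_s15, traceIntegral_apply_s15, h, map_sum]
  calc ∑ i, LinearMap.trace k A (comulContractLeft (b.coord i) ∘ₗ N ∘ₗ m i)
      = ∑ i, LinearMap.trace k A (N ∘ₗ m i ∘ₗ comulContractLeft (b.coord i)) :=
        Finset.sum_congr rfl fun i _ ↦ by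
          rw [LinearMap.trace_comp_comm', LinearMap.comp_assoc]
    _ = LinearMap.trace k A (N ∘ₗ ∑ i, m i ∘ₗ comulContractLeft (b.coord i)) := by
        rw [← map_sum]
        congr 1
        ext y
        simp
    _ = φ 1 * LinearMap.trace k A N := by
        rw [sum_comulContractLeft_comp_comulContractLeft_coord, LinearMap.comp_smul, map_smul,
          LinearMap.comp_id, smul_eq_mul]

lemma sum_traceIntegral_coord [FiniteDimensional k A] {ι : Type*} [Fintype ι]
    (b : Module.Basis ι k A) :
    ∑ j, traceIntegral_s15 (b.coord j) (antipode k (b j)) = 1 := by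
  have h : ∑ j, LinearMap.mulLeft k (antipode k (b j)) ∘ₗ antipode k ∘ₗ antipode k ∘ₗ
      comulContractRight (b.coord j) = (counit : A →ₗ[k] k).smulRight 1 := by
    ext y
    have h' := congrArg (LinearMap.mul' k A ∘ₗ (antipode k).rTensor A)
      (sum_comulContractRight_tmul_basis b y)
    have h'' := congrArg (antipode k) h'
    simpa [antipode_mul_antidistrib, Algebra.algebraMap_eq_smul_one] using h''
  simp only [traceIntegral_apply_s15, ← map_sum, h]
  simp [LinearMap.trace_smulRight]

/-- A finite-dimensional Hopf algebra has a nonzero integral in its dual. -/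
lemma exists_ne_zero_comulContractRight_eq (k A : Type*) [Field k] [Ring A] [HopfAlgebra k A]
    [FiniteDimensional k A] :
    ∃ f : A →ₗ[k] k, f ≠ 0 ∧ ∀ x, comulContractRight f x = f x • (1 : A) := by
  let b := Module.finBasis k A
  obtain ⟨j, -, hj⟩ := Finset.exists_ne_zero_of_sum_ne_zero
    ((sum_traceIntegral_coord b).trans_ne one_ne_zero)
  refine ⟨traceIntegral_s15 (b.coord j), fun h ↦ hj (by simp [h]), fun x ↦ ?_⟩
  refine (Module.forall_dual_apply_eq_zero_iff k _).1 ?_ |> sub_eq_zero.1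
  intro φ
  have h := traceIntegral_comulContractLeft (b.coord j) φ x
  rw [map_sub, sub_eq_zero, map_smul, smul_eq_mul, mul_comm, ← h, comulContractLeft_apply,
    comulContractRight_apply]
  generalize comul (R := k) x = t
  induction t with
  | zero => simp
  | add u v hu hv => simp only [map_add, hu, hv]
  | tmul u v => simp [mul_comm]

/-- If `λ` is an integral, then `∑ x₍₁₎ λ(x₍₂₎ S(a)) = ∑ λ(x S(a₍₁₎)) a₍₂₎`. -/
lemma sum_mul_antipode_smul_eq {f : A →ₗ[k] k} (hf : ∀ x, comulContractRight f x = f x • (1 : A))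
    (x : A) {ι : Type*} {a : A} (r : Repr k a ι) :
    ∑ i ∈ r.index, f (x * antipode k (r.left i)) • r.right i =
      TensorProduct.rid k A (f.lTensor A (comul x * ((1 : A) ⊗ₜ[k] antipode k a))) := by
  have h := congr($(comul_antipode_convMul_includeLeft (R := k) (A := A)) a)
  rw [r.convMul_apply] at h
  have h' : (1 : A) ⊗ₜ[k] antipode k a = ∑ i ∈ r.index,
      comul (antipode k (r.left i)) * (r.right i ⊗ₜ[k] (1 : A)) := by simpa using h.symm
  have hr : ∀ (t : A ⊗[k] A) (c : A), TensorProduct.rid k A (f.lTensor A (t * (c ⊗ₜ[k] (1 : A)))) =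
      TensorProduct.rid k A (f.lTensor A t) * c := by
    intro t c
    induction t with
    | zero => simp
    | add u v hu hv => simp only [map_add, add_mul, hu, hv]
    | tmul u v => simp
  simp only [h', Finset.mul_sum, ← mul_assoc, ← Bialgebra.comul_mul, map_sum, hr,
    ← comulContractRight_apply, hf, smul_mul_assoc, one_mul]

/-- For an integral `λ`, the elements `a` with `λ(x S(a)) = 0` for all `x` form a coideal. -/
lemma apply_mul_antipode_comulContractRight_eq_zero {f : A →ₗ[k] k}
    (hf : ∀ x, comulContractRight f x = f x • (1 : A)) {a : A}
    (ha : ∀ x, f (x * antipode k a) = 0) (φ : A →ₗ[k] k) (x : A) :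
    f (x * antipode k (comulContractRight φ a)) = 0 := by
  have h₀ : ∀ t : A ⊗[k] A, f.lTensor A (t * ((1 : A) ⊗ₜ[k] antipode k a)) = 0 := by
    intro t
    induction t with
    | zero => simp
    | add u v hu hv => simp only [map_add, add_mul, hu, hv, add_zero]
    | tmul u v => simp [ha]
  have h := congrArg φ (sum_mul_antipode_smul_eq hf x (ℛ k a))
  rw [h₀, map_zero, map_zero] at h
  rw [comulContractRight_apply, ← (ℛ k a).eq]
  simpa [mul_comm, Finset.mul_sum] using h

theorem antipode_injective (k A : Type*) [Field k] [Ring A] [HopfAlgebra k A]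
    [FiniteDimensional k A] : Function.Injective (antipode k : A →ₗ[k] A) := by
  obtain ⟨f, hf₀, hf⟩ := exists_ne_zero_comulContractRight_eq k A
  obtain ⟨x, hx⟩ := DFunLike.ne_iff.1 hf₀
  rw [LinearMap.zero_apply] at hx
  let b := Module.finBasis k A
  have counit_eq_zero : ∀ c : A,
      (∀ φ : A →ₗ[k] k, ∀ y, f (y * antipode k (comulContractRight φ c)) = 0) →
        counit (R := k) c = 0 := by
    intro c hc
    have h := congrArg (fun t ↦ f (x * antipode k (LinearMap.mul' k A ((antipode k).lTensor A t))))
      (sum_comulContractRight_tmul_basis b c)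
    simp only [map_sum, LinearMap.lTensor_tmul, LinearMap.mul'_apply, antipode_mul_antidistrib,
      ← mul_assoc, Finset.mul_sum, hc, Finset.sum_const_zero] at h
    simpa [Algebra.algebraMap_eq_smul_one, hx] using h.symm
  rw [injective_iff_map_eq_zero]
  intro a ha
  have ha' := apply_mul_antipode_comulContractRight_eq_zero hf (a := a) (by simp [ha])
  refine (Module.forall_dual_apply_eq_zero_iff k a).1 fun φ ↦ ?_
  rw [← counit_comulContractRight]
  exact counit_eq_zero _ fun ψ ↦ apply_mul_antipode_comulContractRight_eq_zero hf (ha' φ) ψ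

end HopfAlgebra

/-- The antipode of a finite-dimensional Hopf algebra over a field is bijective. -/
theorem antipode_bijective (k A : Type*) [Field k] [Ring A] [HopfAlgebra k A]
    [FiniteDimensional k A] :
    Function.Bijective (HopfAlgebra.antipode (R := k) (A := A)) := by
  have h := HopfAlgebra.antipode_injective k A
  exact ⟨h, LinearMap.injective_iff_surjective.1 h⟩
end
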